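/- arXiv:1011.2315 — 2 statements merged into one kernel-verified Lean document; each statement's English description precedes it below -/
import Mathlib

section
/- In the setting of Proposition 1 with squared-error loss (X₁, X₂ ∈ ℝⁿ centered with unit Euclidean norm, y ∈ ℝⁿ centered, s ∈ {−1,1}, λ₁, λ₂ > 0, Λ = (1/2)[[1, s],[s, 1]], and β̂ a minimizer of ‖y − β₁X₁ − β₂X₂‖² + λ₁(|β₁|+|β₂|) + λ₂βᵀΛβ satisfying −s β̂₁ β̂₂ > 0): if in addition X₁ = −s X₂, then β̂₁ = −s β̂₂. -/
/-- In the setting of Proposition 1 with squared-error loss: if additionally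
`X₁ = −s X₂`, then the structured elastic net minimizer satisfies `β̂₁ = −s β̂₂`. -/
theorem grouping_property_equal_coefficients (n : ℕ) (hn : 1 ≤ n)
    (X1 X2 y : Fin n → ℝ)
    (hX1c : ∑ i, X1 i = 0) (hX2c : ∑ i, X2 i = 0) (hyc : ∑ i, y i = 0)
    (hX1n : ∑ i, (X1 i) ^ 2 = 1) (hX2n : ∑ i, (X2 i) ^ 2 = 1)
    (s : ℝ) (hs : s = 1 ∨ s = -1)
    (lam1 lam2 : ℝ) (hlam1 : 0 < lam1) (hlam2 : 0 < lam2)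
    (βhat1 βhat2 : ℝ)
    (hmin : ∀ b1 b2 : ℝ,
      ∑ i, (y i - b1 * X1 i - b2 * X2 i) ^ 2 + lam1 * (|b1| + |b2|)
        + lam2 * ((b1 ^ 2 + 2 * s * b1 * b2 + b2 ^ 2) / 2)
      ≥ ∑ i, (y i - βhat1 * X1 i - βhat2 * X2 i) ^ 2 + lam1 * (|βhat1| + |βhat2|)
        + lam2 * ((βhat1 ^ 2 + 2 * s * βhat1 * βhat2 + βhat2 ^ 2) / 2))
    (hsign : -s * βhat1 * βhat2 > 0)
    (hcol : X1 = fun i => -s * X2 i) :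
    βhat1 = -s * βhat2 := by
  have hs2 : s ^ 2 = 1 := by rcases hs with rfl | rfl <;> norm_num
  have hs_abs : |s| = 1 := by rcases hs with rfl | rfl <;> norm_num
  set m := (βhat1 - s * βhat2) / 2 with hm
  have hmin' := hmin m (-s * m)
  have hfit : ∑ i, (y i - m * X1 i - (-s * m) * X2 i) ^ 2
      = ∑ i, (y i - βhat1 * X1 i - βhat2 * X2 i) ^ 2 := by
    refine Finset.sum_congr rfl fun i _ => ?_
    have hXi : X1 i = -s * X2 i := congrFun hcol i
    congr 1
    rw [hXi, hm]
    linear_combination (-βhat2 * X2 i) * hs2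
  have habs : |m| + |-s * m| ≤ |βhat1| + |βhat2| := by
    have htri : |βhat1 - s * βhat2| ≤ |βhat1| + |s * βhat2| := abs_sub _ _
    rw [abs_mul, hs_abs, one_mul] at htri
    rw [abs_mul, abs_neg, hs_abs, one_mul, hm, abs_div, abs_two]
    linarith
  have hpen : m ^ 2 + 2 * s * m * (-s * m) + (-s * m) ^ 2 = 0 := by
    linear_combination (-m ^ 2) * hs2
  have hpen' : βhat1 ^ 2 + 2 * s * βhat1 * βhat2 + βhat2 ^ 2 = (βhat1 + s * βhat2) ^ 2 := by
    linear_combination (-βhat2 ^ 2) * hs2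
  rw [hfit, hpen, hpen'] at hmin'
  have hle : lam2 * (βhat1 + s * βhat2) ^ 2 ≤ 0 := by
    linarith [mul_le_mul_of_nonneg_left habs hlam1.le]
  have hsq : (βhat1 + s * βhat2) ^ 2 = 0 :=
    le_antisymm (nonpos_of_mul_nonpos_right hle hlam2) (sq_nonneg _)
  linarith [pow_eq_zero_iff (two_ne_zero) |>.mp hsq]
end

section
/- Let X be an n × p real matrix, y ∈ ℝⁿ, λ₁ > 0, λ₂ > 0, and let Q be an m × p real matrix with Λ = QᵀQ. Define the augmented design matrix X̃ of size (n + m) × p by stacking X on top of √λ₂ · Q, and the augmented response ỹ ∈ ℝ^{n+m} by appending m zeros to y. Then for every β ∈ ℝᵖ, ‖ỹ − X̃β‖² + λ₁‖β‖₁ = ‖y − Xβ‖² + λ₂ βᵀΛβ + λ₁‖β‖₁. Consequently, β̂ minimizes the structured elastic net objective ‖y − Xβ‖² + λ₁‖β‖₁ + λ₂ βᵀΛβ if and only if β̂ minimizes the lasso objective ‖ỹ − X̃β‖² + λ₁‖β‖₁ on the augmented data. -/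
open Matrix

theorem Matrix.dotProduct_transpose_mul_self_mulVec {m p R : Type*} [Fintype m] [Fintype p]
    [CommSemiring R] (Q : Matrix m p R) (v : p → R) :
    v ⬝ᵥ (Qᵀ * Q) *ᵥ v = ∑ i, (Q *ᵥ v) i ^ 2 := by
  rw [← mulVec_mulVec, dotProduct_mulVec, vecMul_transpose]
  simp only [dotProduct, sq]

theorem Matrix.sum_sq_sub_fromRows_sqrt_smul_mulVec {n m p : Type*} [Fintype n] [Fintype m]
    [Fintype p] (X : Matrix n p ℝ) (y : n → ℝ) (Q : Matrix m p ℝ) {c : ℝ} (hc : 0 ≤ c)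
    (v : p → ℝ) :
    ∑ i, ((Sum.elim y 0 : n ⊕ m → ℝ) i - (fromRows X (Real.sqrt c • Q) *ᵥ v) i) ^ 2
      = ∑ i, (y i - (X *ᵥ v) i) ^ 2 + c * (v ⬝ᵥ (Qᵀ * Q) *ᵥ v) := by
  rw [dotProduct_transpose_mul_self_mulVec, Finset.mul_sum]
  simp [fromRows_mulVec, smul_mulVec, mul_pow, Real.sq_sqrt hc]

/-- Augmented data representation of the structured elastic net: with
`X̃ = [X; √λ₂ Q]`, `ỹ = (y, 0)` and `Λ = QᵀQ`, for every `β` one has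
`‖ỹ − X̃β‖² + λ₁‖β‖₁ = ‖y − Xβ‖² + λ₂ βᵀΛβ + λ₁‖β‖₁`; consequently `β̂` minimizes
the structured elastic net objective iff it minimizes the lasso objective on the
augmented data. -/
theorem structured_elastic_net_augmented_data (n m p : ℕ)
    (X : Matrix (Fin n) (Fin p) ℝ) (y : Fin n → ℝ)
    (lam1 lam2 : ℝ) (hlam1 : 0 < lam1) (hlam2 : 0 < lam2)
    (Q : Matrix (Fin m) (Fin p) ℝ)
    (Lam : Matrix (Fin p) (Fin p) ℝ) (hLam : Lam = Qᵀ * Q)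
    (Xtil : Matrix (Fin n ⊕ Fin m) (Fin p) ℝ)
    (hXtil : Xtil = Matrix.fromRows X (Real.sqrt lam2 • Q))
    (ytil : Fin n ⊕ Fin m → ℝ) (hytil : ytil = Sum.elim y 0) :
    (∀ β : Fin p → ℝ,
      ∑ i, (ytil i - Xtil.mulVec β i) ^ 2 + lam1 * ∑ j, |β j|
        = ∑ i, (y i - X.mulVec β i) ^ 2 + lam2 * (β ⬝ᵥ Lam.mulVec β)
            + lam1 * ∑ j, |β j|)
    ∧ ∀ βhat : Fin p → ℝ,
        ((∀ β : Fin p → ℝ,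
          ∑ i, (y i - X.mulVec βhat i) ^ 2 + lam1 * ∑ j, |βhat j|
              + lam2 * (βhat ⬝ᵥ Lam.mulVec βhat)
            ≤ ∑ i, (y i - X.mulVec β i) ^ 2 + lam1 * ∑ j, |β j|
              + lam2 * (β ⬝ᵥ Lam.mulVec β))
          ↔
          (∀ β : Fin p → ℝ,
            ∑ i, (ytil i - Xtil.mulVec βhat i) ^ 2 + lam1 * ∑ j, |βhat j|
              ≤ ∑ i, (ytil i - Xtil.mulVec β i) ^ 2 + lam1 * ∑ j, |β j|)) := by
  subst hLam hXtil hytil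
  simp only [sum_sq_sub_fromRows_sqrt_smul_mulVec X y Q hlam2.le, true_and, implies_true,
    add_right_comm]
end
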